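/- Let ℓ be a Boolean function on n variables. If ℓ has an orientation β of weight at most w₁ and its pointwise complement ¬ℓ has an orientation γ of weight at most w₂, then there is a set S of at most w₁ + w₂ indices (namely the union of the supports of β and γ) such that ℓ(x) = ℓ(y) whenever x and y agree on all coordinates in S; i.e., ℓ depends on at most w₁ + w₂ of its inputs. -/

import Mathlib

/-- `β` is an orientation of the Boolean function `f` on `n` variables:
there is a monotone Boolean function `h : {0,1}^{2n} → {0,1}` (modeled as a
monotone function on the product, ordered coordinatewise) with
`f x = h (x, x ⊕ β)` for all `x`, where `⊕` is coordinatewise XOR. -/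
def IsOrientation {n : ℕ} (f : (Fin n → Bool) → Bool) (β : Fin n → Bool) : Prop :=
  ∃ h : (Fin n → Bool) × (Fin n → Bool) → Bool,
    Monotone h ∧ ∀ x : Fin n → Bool, f x = h (x, fun i => xor (x i) (β i))

/-- A function with orientation `β` is monotone along coordinates outside the support of `β`. -/
theorem IsOrientation.le_of_le {n : ℕ} {f : (Fin n → Bool) → Bool} {β : Fin n → Bool}
    (hf : IsOrientation f β) {x y : Fin n → Bool} (hxy : x ≤ y)
    (hagree : ∀ i, β i = true → x i = y i) : f x ≤ f y := by
  obtain ⟨h, hmono, hfh⟩ := hf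
  rw [hfh x, hfh y]
  refine hmono ⟨hxy, fun i => ?_⟩
  cases hi : β i with
  | false => simpa [hi] using hxy i
  | true => simp [hi, hagree i hi]

/-- Comparable points that agree on the supports of an orientation of `f` and an orientation of
its complement have the same value under `f`. -/
theorem IsOrientation.eq_of_le {n : ℕ} {f : (Fin n → Bool) → Bool} {β γ : Fin n → Bool}
    (hβ : IsOrientation f β) (hγ : IsOrientation (fun x => !(f x)) γ)
    {x y : Fin n → Bool} (hxy : x ≤ y)
    (hagree : ∀ i, β i = true ∨ γ i = true → x i = y i) : f x = f y := by
  have h₁ := hβ.le_of_le hxy fun i hi => hagree i (Or.inl hi)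
  have h₂ := hγ.le_of_le hxy fun i hi => hagree i (Or.inr hi)
  exact le_antisymm h₁ (compl_le_compl_iff_le.mp h₂)

/-- If `ℓ` has an orientation `β` of weight at most `w₁` and its complement
has an orientation `γ` of weight at most `w₂`, then `ℓ` depends only on the
at most `w₁ + w₂` coordinates in the union of the supports of `β` and `γ`. -/
theorem depends_on_few_inputs {n : ℕ} (ℓ : (Fin n → Bool) → Bool)
    (β γ : Fin n → Bool) (w₁ w₂ : ℕ)
    (hβ : IsOrientation ℓ β)
    (hwβ : (Finset.univ.filter fun i : Fin n => β i = true).card ≤ w₁)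
    (hγ : IsOrientation (fun x => !(ℓ x)) γ)
    (hwγ : (Finset.univ.filter fun i : Fin n => γ i = true).card ≤ w₂) :
    ∃ S : Finset (Fin n),
      S = (Finset.univ.filter fun i : Fin n => β i = true) ∪
          (Finset.univ.filter fun i : Fin n => γ i = true) ∧
      S.card ≤ w₁ + w₂ ∧
      ∀ x y : Fin n → Bool, (∀ i ∈ S, x i = y i) → ℓ x = ℓ y := by
  refine ⟨_, rfl, (Finset.card_union_le _ _).trans (add_le_add hwβ hwγ), fun x y hxy => ?_⟩
  have hagree : ∀ i, β i = true ∨ γ i = true → x i = y i := fun i hi => hxy i (by simpa using hi)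
  have hx : ℓ (x ⊓ y) = ℓ x := hβ.eq_of_le hγ inf_le_left fun i hi => by simp [hagree i hi]
  have hy : ℓ (x ⊓ y) = ℓ y := hβ.eq_of_le hγ inf_le_right fun i hi => by simp [hagree i hi]
  exact hx.symm.trans hy
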